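/- There exists a constant C = C(q) such that for every Q ∈ F_q[t] of degree m ≥ 2 and every d ≥ 1, |∑_{f monic, deg f = d, gcd(f,Q) = 1} μ(f)| ≤ C · q^{d/2 + C·m/log m}, where log denotes the natural logarithm. -/

import Mathlib

open Polynomial

/- The Möbius function on `F_q[t]`. -/
open scoped Classical in
noncomputable def polyMu {F : Type*} [Field F] (f : Polynomial F) : ℤ :=
  if Squarefree f then (-1) ^ (UniqueFactorizationMonoid.normalizedFactors f).card else 0

/-- The monic polynomial of degree `d` whose lower coefficient vector is `x ∈ F_q^d`. -/
noncomputable def monicPoly (F : Type*) [Field F] (d : ℕ) (x : Fin d → F) : Polynomial F :=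
  X ^ d + ∑ i : Fin d, C (x i) * X ^ (i : ℕ)

open scoped Classical in
/-- The finite set of monic polynomials of degree `d` over a finite field. -/
noncomputable def monicsOfDegree (F : Type*) [Field F] [Fintype F] (d : ℕ) :
    Finset (Polynomial F) :=
  Finset.univ.image (monicPoly F d)

open scoped Classical in
/-- The monic polynomials of degree `d` divisible by no element of `S`. -/
noncomputable def monicsAvoiding {F : Type*} [Field F] [Fintype F] (S : Finset (Polynomial F))
    (d : ℕ) : Finset (Polynomial F) :=
  (monicsOfDegree F d).filter fun f => ∀ P ∈ S, ¬ P ∣ f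

section Basic

variable {F : Type*} [Field F]

lemma degree_monicPoly_tail_lt (d : ℕ) (x : Fin d → F) :
    (∑ i : Fin d, C (x i) * X ^ (i : ℕ)).degree < (d : WithBot ℕ) := by
  refine (degree_sum_le _ _).trans_lt ((Finset.sup_lt_iff (WithBot.bot_lt_coe d)).2 fun i _ => ?_)
  exact (degree_C_mul_X_pow_le _ _).trans_lt (WithBot.coe_lt_coe.2 i.2)

lemma monicPoly_monic (d : ℕ) (x : Fin d → F) : (monicPoly F d x).Monic :=
  monic_X_pow_add (degree_monicPoly_tail_lt d x)

lemma natDegree_monicPoly (d : ℕ) (x : Fin d → F) : (monicPoly F d x).natDegree = d := by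
  apply natDegree_eq_of_degree_eq_some
  rw [monicPoly, degree_add_eq_left_of_degree_lt] <;> rw [degree_X_pow]
  exact degree_monicPoly_tail_lt d x

lemma coeff_monicPoly (d : ℕ) (x : Fin d → F) (i : Fin d) :
    (monicPoly F d x).coeff i = x i := by
  have hi : (i : ℕ) ≠ d := i.2.ne
  simp [monicPoly, coeff_X_pow, hi, ← Fin.ext_iff]

lemma monicPoly_injective (d : ℕ) : Function.Injective (monicPoly F d) := fun x y h =>
  funext fun i => by rw [← coeff_monicPoly d x, h, coeff_monicPoly]

lemma monicPoly_coeff {d : ℕ} {f : Polynomial F} (hf : f.Monic) (hd : f.natDegree = d) :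
    monicPoly F d (fun i => f.coeff i) = f := by
  conv_rhs => rw [hf.as_sum, hd]
  rw [monicPoly, Fin.sum_univ_eq_sum_range (fun i => C (f.coeff i) * X ^ i)]

lemma Polynomial.Monic.eq_of_irreducible_of_dvd {P R : Polynomial F} (hP : P.Monic) (hR : R.Monic)
    (hPi : Irreducible P) (hRi : Irreducible R) (h : P ∣ R) : P = R :=
  eq_of_monic_of_associated hP hR (hPi.associated_of_dvd hRi h)

open scoped Classical in
lemma polyMu_mul_of_irreducible {P f : Polynomial F} (hP : Irreducible P) (hf : f ≠ 0) :
    polyMu (P * f) = if P ∣ f then 0 else -polyMu f := by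
  have hsq : Squarefree (P * f) ↔ ¬ P ∣ f ∧ Squarefree f := by
    rw [squarefree_mul_iff, ← hP.coprime_iff_not_dvd, ← isRelPrime_iff_isCoprime]
    exact ⟨fun h => ⟨h.1, h.2.2⟩, fun h => ⟨h.1, hP.squarefree, h.2⟩⟩
  by_cases hd : P ∣ f
  · simp [polyMu, hsq, hd]
  · by_cases hs : Squarefree f
    · simp only [polyMu, hsq, hd, hs, not_false_eq_true, and_self, if_true, if_false]
      rw [UniqueFactorizationMonoid.normalizedFactors_mul hP.ne_zero hf,
        UniqueFactorizationMonoid.normalizedFactors_irreducible hP]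
      simp [pow_add]
    · simp [polyMu, hsq, hd, hs]

lemma polyMu_one : polyMu (1 : Polynomial F) = 1 := by
  simp [polyMu]

end Basic

section Counting

variable {F : Type*} [Field F] [Fintype F]

lemma mem_monicsOfDegree {d : ℕ} {f : Polynomial F} :
    f ∈ monicsOfDegree F d ↔ f.Monic ∧ f.natDegree = d := by
  simp only [monicsOfDegree, Finset.mem_image, Finset.mem_univ, true_and]
  constructor
  · rintro ⟨x, rfl⟩
    exact ⟨monicPoly_monic d x, natDegree_monicPoly d x⟩
  · rintro ⟨hf, hd⟩
    exact ⟨_, monicPoly_coeff hf hd⟩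

lemma card_monicsOfDegree (d : ℕ) : (monicsOfDegree F d).card = Fintype.card F ^ d := by
  classical
  rw [monicsOfDegree, Finset.card_image_of_injective _ (monicPoly_injective d)]
  simp

lemma mem_monicsAvoiding {S : Finset (Polynomial F)} {d : ℕ} {f : Polynomial F} :
    f ∈ monicsAvoiding S d ↔ (f.Monic ∧ f.natDegree = d) ∧ ∀ P ∈ S, ¬ P ∣ f := by
  simp [monicsAvoiding, mem_monicsOfDegree]

lemma monicsAvoiding_empty (d : ℕ) : monicsAvoiding (∅ : Finset (Polynomial F)) d =
    monicsOfDegree F d := by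
  simp [monicsAvoiding]

open scoped Classical in
/-- Splitting the monic polynomials avoiding `S` according to divisibility by a further prime. -/
lemma sum_monicsAvoiding_eq {S : Finset (Polynomial F)}
    (hS : ∀ P ∈ S, P.Monic ∧ Irreducible P) {P : Polynomial F} (hP : P.Monic)
    (hPi : Irreducible P) (hPS : P ∉ S) (g : Polynomial F → ℤ) (d : ℕ) :
    ∑ f ∈ monicsAvoiding S d, g f = ∑ f ∈ monicsAvoiding (insert P S) d, g f +
      if P.natDegree ≤ d then ∑ f ∈ monicsAvoiding S (d - P.natDegree), g (P * f) else 0 := by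
  rw [← Finset.sum_filter_not_add_sum_filter _ (fun f => P ∣ f)]
  congr 1
  · refine Finset.sum_congr ?_ fun _ _ => rfl
    ext f
    simp only [Finset.mem_filter, mem_monicsAvoiding, Finset.forall_mem_insert]
    tauto
  · split_ifs with hle
    · symm
      refine Finset.sum_bij (fun f _ => P * f) ?_ ?_ ?_ fun _ _ => rfl
      · intro f hf
        rw [mem_monicsAvoiding] at hf
        rw [Finset.mem_filter, mem_monicsAvoiding]
        refine ⟨⟨⟨hP.mul hf.1.1, ?_⟩, fun R hR hdvd => ?_⟩, dvd_mul_right _ _⟩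
        · rw [hP.natDegree_mul hf.1.1, hf.1.2]
          omega
        · rcases (hS R hR).2.prime.dvd_or_dvd hdvd with h | h
          · exact hPS ((hS R hR).1.eq_of_irreducible_of_dvd hP (hS R hR).2 hPi h ▸ hR)
          · exact hf.2 R hR h
      · intro a _ b _ h
        exact mul_left_cancel₀ hPi.ne_zero h
      · intro f hf
        rw [Finset.mem_filter, mem_monicsAvoiding] at hf
        obtain ⟨⟨⟨hm, hd⟩, hav⟩, c, rfl⟩ := hf
        have hc : c.Monic := hP.of_mul_monic_left hm
        refine ⟨c, mem_monicsAvoiding.2 ⟨⟨hc, ?_⟩, fun R hR h => hav R hR (h.mul_left P)⟩, rfl⟩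
        rw [← hd, hP.natDegree_mul hc]
        omega
    · refine Finset.sum_eq_zero fun f hf => absurd ?_ hle
      rw [Finset.mem_filter, mem_monicsAvoiding] at hf
      exact hf.1.1.2 ▸ natDegree_le_of_dvd hf.2 hf.1.1.1.ne_zero

/-- The generating function of the Möbius function on monic polynomials avoiding `S`. -/
noncomputable def moebiusSeries (S : Finset (Polynomial F)) : PowerSeries ℤ :=
  PowerSeries.mk fun d => ∑ f ∈ monicsAvoiding S d, polyMu f

/-- The generating function counting monic polynomials avoiding `S`. -/
noncomputable def countSeries (S : Finset (Polynomial F)) : PowerSeries ℤ :=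
  PowerSeries.mk fun d => ∑ _f ∈ monicsAvoiding S d, 1

open scoped Classical in
lemma moebiusSeries_eq_mul {S : Finset (Polynomial F)}
    (hS : ∀ P ∈ S, P.Monic ∧ Irreducible P) {P : Polynomial F} (hP : P.Monic)
    (hPi : Irreducible P) (hPS : P ∉ S) :
    moebiusSeries S = (1 - PowerSeries.X ^ P.natDegree) * moebiusSeries (insert P S) := by
  ext d
  rw [sub_mul, one_mul, map_sub, PowerSeries.coeff_X_pow_mul']
  simp only [moebiusSeries, PowerSeries.coeff_mk]
  rw [sum_monicsAvoiding_eq hS hP hPi hPS, sub_eq_add_neg]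
  congr 1
  split_ifs with hle
  · rw [← Finset.sum_neg_distrib]
    symm
    apply Finset.sum_subset_zero_on_sdiff
    · intro f
      simp only [mem_monicsAvoiding, Finset.forall_mem_insert]
      tauto
    · intro f hf
      simp only [Finset.mem_sdiff, mem_monicsAvoiding, Finset.forall_mem_insert] at hf
      rw [polyMu_mul_of_irreducible hPi hf.1.1.1.ne_zero, if_pos]
      tauto
    · intro f hf
      simp only [mem_monicsAvoiding, Finset.forall_mem_insert] at hf
      rw [polyMu_mul_of_irreducible hPi hf.1.1.ne_zero, if_neg hf.2.1]
  · simp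

open scoped Classical in
lemma countSeries_insert {S : Finset (Polynomial F)}
    (hS : ∀ P ∈ S, P.Monic ∧ Irreducible P) {P : Polynomial F} (hP : P.Monic)
    (hPi : Irreducible P) (hPS : P ∉ S) :
    countSeries (insert P S) = (1 - PowerSeries.X ^ P.natDegree) * countSeries S := by
  ext d
  rw [sub_mul, one_mul, map_sub, PowerSeries.coeff_X_pow_mul']
  simp only [countSeries, PowerSeries.coeff_mk]
  rw [sum_monicsAvoiding_eq hS hP hPi hPS]
  ring

lemma moebiusSeries_mul_countSeries (S : Finset (Polynomial F))
    (hS : ∀ P ∈ S, P.Monic ∧ Irreducible P) :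
    moebiusSeries S * countSeries S = moebiusSeries (F := F) ∅ * countSeries (F := F) ∅ := by
  classical
  induction S using Finset.induction_on with
  | empty => rfl
  | insert P S hPS ih =>
    rw [Finset.forall_mem_insert] at hS
    rw [← ih hS.2, countSeries_insert hS.2 hS.1.1 hS.1.2 hPS,
      moebiusSeries_eq_mul hS.2 hS.1.1 hS.1.2 hPS]
    ring

lemma monicsAvoiding_zero {S : Finset (Polynomial F)} (hS : ∀ P ∈ S, P.Monic ∧ Irreducible P) :
    monicsAvoiding S 0 = {1} := by
  ext f
  rw [mem_monicsAvoiding, Finset.mem_singleton]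
  constructor
  · rintro ⟨⟨hm, hd⟩, -⟩
    exact hm.natDegree_eq_zero.1 hd
  · rintro rfl
    exact ⟨⟨monic_one, natDegree_one⟩, fun P hP h => (hS P hP).2.not_isUnit (isUnit_of_dvd_one h)⟩

lemma moebiusSeries_empty_mul_countSeries_empty :
    moebiusSeries (F := F) ∅ * countSeries (F := F) ∅ = 1 := by
  classical
  ext d
  set S : Finset (Polynomial F) :=
    ((Finset.range (d + 1)).biUnion (monicsOfDegree F)).filter Irreducible with hSdef
  have hmem : ∀ P, P ∈ S ↔ (P.natDegree ≤ d ∧ P.Monic) ∧ Irreducible P := by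
    intro P
    simp [hSdef, mem_monicsOfDegree, and_comm]
  have hS : ∀ P ∈ S, P.Monic ∧ Irreducible P := fun P hP =>
    ⟨((hmem P).1 hP).1.2, ((hmem P).1 hP).2⟩
  have hempty : ∀ i, 1 ≤ i → i ≤ d → monicsAvoiding S i = ∅ := by
    intro i h1 h2
    refine Finset.eq_empty_of_forall_notMem fun f hf => ?_
    obtain ⟨⟨hm, hd⟩, hav⟩ := mem_monicsAvoiding.1 hf
    have hf1 : f ≠ 1 := by
      rintro rfl
      simp at hd
      omega
    obtain ⟨P, hPm, hPi, hPf⟩ := exists_monic_irreducible_factor f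
      (fun h => hf1 (hm.eq_one_of_isUnit h))
    exact hav P ((hmem P).2 ⟨⟨(natDegree_le_of_dvd hPf hm.ne_zero).trans (hd.trans_le h2), hPm⟩,
      hPi⟩) hPf
  rw [← moebiusSeries_mul_countSeries S hS, PowerSeries.coeff_mul, PowerSeries.coeff_one]
  simp only [moebiusSeries, countSeries, PowerSeries.coeff_mk]
  split_ifs with hd
  · subst hd
    simp [monicsAvoiding_zero hS, polyMu_one]
  · refine Finset.sum_eq_zero fun p hp => ?_
    rw [Finset.HasAntidiagonal.mem_antidiagonal] at hp
    rcases Nat.eq_zero_or_pos p.1 with h | h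
    · rw [hempty p.2 (by omega) (by omega)]
      simp
    · rw [hempty p.1 h (by omega)]
      simp

lemma moebiusSeries_empty :
    moebiusSeries (F := F) ∅ = 1 - PowerSeries.C (Fintype.card F : ℤ) * PowerSeries.X := by
  have h : countSeries (F := F) ∅ *
      (1 - PowerSeries.C (Fintype.card F : ℤ) * PowerSeries.X) = 1 := by
    ext d
    rw [mul_sub, mul_one, map_sub, ← mul_assoc, mul_comm _ (PowerSeries.C _), mul_assoc,
      PowerSeries.coeff_C_mul]
    cases d with
    | zero => simp [countSeries, monicsAvoiding_empty, card_monicsOfDegree]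
    | succ d =>
      rw [PowerSeries.coeff_succ_mul_X]
      simp [countSeries, monicsAvoiding_empty, card_monicsOfDegree, PowerSeries.coeff_one,
        pow_succ, mul_comm]
  calc moebiusSeries (F := F) ∅ = moebiusSeries (F := F) ∅ * (countSeries (F := F) ∅ *
      (1 - PowerSeries.C (Fintype.card F : ℤ) * PowerSeries.X)) := by rw [h, mul_one]
    _ = _ := by rw [← mul_assoc, moebiusSeries_empty_mul_countSeries_empty, one_mul]

lemma one_lt_sqrt_card : 1 < √(Fintype.card F : ℝ) := by
  rw [Real.lt_sqrt zero_le_one]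
  exact_mod_cast Fintype.one_lt_card

lemma abs_coeff_moebiusSeries_empty_le (d : ℕ) :
    |((PowerSeries.coeff d (moebiusSeries (F := F) ∅) : ℤ) : ℝ)| ≤
      √(Fintype.card F : ℝ) * √(Fintype.card F : ℝ) ^ d := by
  have h1 := one_lt_sqrt_card (F := F)
  have hsq : √(Fintype.card F : ℝ) * √(Fintype.card F : ℝ) = Fintype.card F :=
    Real.mul_self_sqrt (by positivity)
  rw [moebiusSeries_empty, map_sub, PowerSeries.coeff_C_mul, PowerSeries.coeff_one,
    PowerSeries.coeff_X]
  rcases d with _ | _ | d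
  · simpa using h1.le
  · simp [hsq]
  · simp
    positivity

open scoped Classical in
lemma abs_coeff_moebiusSeries_le (S : Finset (Polynomial F))
    (hS : ∀ P ∈ S, P.Monic ∧ Irreducible P) (d : ℕ) :
    |((PowerSeries.coeff d (moebiusSeries S) : ℤ) : ℝ)| ≤
      √(Fintype.card F : ℝ) * (∏ P ∈ S, (1 - (√(Fintype.card F : ℝ))⁻¹ ^ P.natDegree)⁻¹) *
        √(Fintype.card F : ℝ) ^ d := by
  induction S using Finset.induction_on generalizing d with
  | empty => simpa using abs_coeff_moebiusSeries_empty_le d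
  | insert P S hPS ih =>
    have hs := one_lt_sqrt_card (F := F)
    rw [Finset.forall_mem_insert] at hS
    rw [Finset.prod_insert hPS]
    set s := √(Fintype.card F : ℝ)
    set A := ∏ P ∈ S, (1 - s⁻¹ ^ P.natDegree)⁻¹
    have hk : 0 < P.natDegree := hS.1.2.natDegree_pos
    have hx : s⁻¹ ^ P.natDegree < 1 :=
      pow_lt_one₀ (by positivity) (inv_lt_one_of_one_lt₀ hs) hk.ne'
    set x := s⁻¹ ^ P.natDegree with hxdef
    have hx0 : 0 < x := by positivity
    have hx1 : 0 < 1 - x := by linarith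
    have hA : 0 ≤ A := by
      refine Finset.prod_nonneg fun R _ => inv_nonneg.2 (sub_nonneg.2 ?_)
      exact pow_le_one₀ (by positivity) (inv_le_one_of_one_le₀ hs.le)
    have hrec := moebiusSeries_eq_mul hS.2 hS.1.1 hS.1.2 hPS
    induction d using Nat.strong_induction_on with
    | _ d ihd =>
      have hc := congrArg (PowerSeries.coeff d) hrec
      rw [sub_mul, one_mul, map_sub, PowerSeries.coeff_X_pow_mul'] at hc
      rw [show PowerSeries.coeff d (moebiusSeries (insert P S)) =
        PowerSeries.coeff d (moebiusSeries S) + _ from eq_add_of_sub_eq hc.symm]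
      push_cast
      have key : s * ((1 - x)⁻¹ * A) * s ^ d = s * A * s ^ d +
          s * ((1 - x)⁻¹ * A) * (x * s ^ d) := by
        field_simp
        ring
      rw [key]
      refine (abs_add_le _ _).trans (add_le_add (ih hS.2 d) ?_)
      split_ifs with hle
      · have hpow : x * s ^ d = s ^ (d - P.natDegree) := by
          rw [hxdef, inv_pow, pow_sub₀ _ (by positivity) hle, mul_comm]
        rw [hpow]
        exact ihd _ (by omega)
      · simp only [abs_zero]
        positivity

lemma sum_pow_natDegree_le (S : Finset (Polynomial F)) (hS : ∀ P ∈ S, P.Monic) :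
    ∑ P ∈ S, ((√(Fintype.card F : ℝ))⁻¹ ^ P.natDegree) ^ 3 ≤
      (1 - (√(Fintype.card F : ℝ))⁻¹)⁻¹ := by
  classical
  have hs := one_lt_sqrt_card (F := F)
  have hsq : √(Fintype.card F : ℝ) * √(Fintype.card F : ℝ) = Fintype.card F :=
    Real.mul_self_sqrt (by positivity)
  set s := √(Fintype.card F : ℝ)
  have hr : s⁻¹ < 1 := inv_lt_one_of_one_lt₀ hs
  have hr0 : 0 ≤ s⁻¹ := by positivity
  obtain ⟨N, hN⟩ : ∃ N, ∀ P ∈ S, P.natDegree < N :=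
    ⟨S.sup natDegree + 1, fun P hP => Nat.lt_succ_of_le (Finset.le_sup (f := natDegree) hP)⟩
  rw [← Finset.sum_fiberwise_of_maps_to (t := Finset.range N) (g := natDegree)
    (fun P hP => Finset.mem_range.2 (hN P hP))]
  calc _ ≤ ∑ k ∈ Finset.range N, s⁻¹ ^ k := by
        refine Finset.sum_le_sum fun k _ => ?_
        have hcard : (S.filter fun P => P.natDegree = k).card ≤ Fintype.card F ^ k := by
          rw [← card_monicsOfDegree]
          refine Finset.card_le_card fun P hP => ?_
          rw [Finset.mem_filter] at hP
          exact mem_monicsOfDegree.2 ⟨hS P hP.1, hP.2⟩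
        calc _ = ∑ P ∈ S with P.natDegree = k, (s⁻¹ ^ k) ^ 3 :=
              Finset.sum_congr rfl fun P hP => by rw [(Finset.mem_filter.1 hP).2]
          _ = ((S.filter fun P => P.natDegree = k).card : ℝ) * (s⁻¹ ^ k) ^ 3 := by
              rw [Finset.sum_const, nsmul_eq_mul]
          _ ≤ (Fintype.card F : ℝ) ^ k * (s⁻¹ ^ k) ^ 3 := by
              gcongr
              exact_mod_cast hcard
          _ = s⁻¹ ^ k := by
              rw [← hsq, mul_pow, inv_pow]
              field_simp
    _ ≤ ∑' k, s⁻¹ ^ k := (summable_geometric_of_lt_one hr0 hr).sum_le_tsum _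
        fun k _ => by positivity
    _ = _ := tsum_geometric_of_lt_one hr0 hr

lemma inv_sqrt_card_le : (√(Fintype.card F : ℝ))⁻¹ ≤ 3 / 4 := by
  have h : (4 / 3 : ℝ) ≤ √(Fintype.card F : ℝ) := by
    apply Real.le_sqrt_of_sq_le
    have : (2 : ℝ) ≤ Fintype.card F := by exact_mod_cast Fintype.one_lt_card (α := F)
    linarith
  rw [inv_le_comm₀ (by linarith) (by norm_num)]
  linarith

lemma prod_inv_one_sub_le_exp (S : Finset (Polynomial F))
    (hS : ∀ P ∈ S, P.Monic ∧ Irreducible P) {m : ℕ} (hm : 0 < m) (hcard : S.card ≤ m) :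
    ∏ P ∈ S, (1 - (√(Fintype.card F : ℝ))⁻¹ ^ P.natDegree)⁻¹ ≤
      Real.exp (20 * ((m : ℝ) ^ (1 / 3 : ℝ)) ^ 2) := by
  have hr := inv_sqrt_card_le (F := F)
  have hsum := sum_pow_natDegree_le S fun P hP => (hS P hP).1
  have hr0 : 0 < (√(Fintype.card F : ℝ))⁻¹ := inv_pos.2 (by linarith [one_lt_sqrt_card (F := F)])
  set r := (√(Fintype.card F : ℝ))⁻¹
  set c := (m : ℝ) ^ (1 / 3 : ℝ) with hcdef
  have hm' : (0 : ℝ) < m := by exact_mod_cast hm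
  have hc : 0 < c := by positivity
  have hc3 : c ^ 3 = m := by
    rw [hcdef, ← Real.rpow_natCast, ← Real.rpow_mul hm'.le]
    norm_num
  have hx : ∀ P ∈ S, r ^ P.natDegree ≤ 3 / 4 := fun P hP =>
    (pow_le_of_le_one hr0.le (by linarith) (hS P hP).2.natDegree_pos.ne').trans hr
  have hfactor : ∀ P ∈ S, (1 - r ^ P.natDegree)⁻¹ ≤ Real.exp (4 * r ^ P.natDegree) := by
    intro P hP
    have h1 := hx P hP
    have h0 : 0 < r ^ P.natDegree := by positivity
    refine le_trans ?_ (Real.add_one_le_exp _)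
    rw [inv_le_iff_one_le_mul₀ (by linarith)]
    nlinarith
  have hterm : ∀ P ∈ S, r ^ P.natDegree ≤ c⁻¹ + c ^ 2 * (r ^ P.natDegree) ^ 3 := by
    intro P _
    have h0 : 0 < r ^ P.natDegree := by positivity
    set x := r ^ P.natDegree
    rcases le_total x c⁻¹ with h | h
    · have : 0 ≤ c ^ 2 * x ^ 3 := by positivity
      linarith
    · have h1 : 1 ≤ c * x := by rwa [inv_le_iff_one_le_mul₀ hc, mul_comm] at h
      have h2 : x * 1 ≤ x * (c * x) ^ 2 := by
        gcongr
        exact one_le_pow₀ h1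
      have : 0 < c⁻¹ := by positivity
      nlinarith
  calc _ ≤ ∏ P ∈ S, Real.exp (4 * r ^ P.natDegree) :=
        Finset.prod_le_prod (fun P hP => inv_nonneg.2 (by linarith [hx P hP])) hfactor
    _ = Real.exp (4 * ∑ P ∈ S, r ^ P.natDegree) := by rw [← Real.exp_sum, Finset.mul_sum]
    _ ≤ _ := by
        apply Real.exp_le_exp.2
        have hinv : (1 - r)⁻¹ ≤ 4 := by
          rw [inv_le_comm₀ (by linarith) (by norm_num)]
          linarith
        have h1 : ∑ P ∈ S, r ^ P.natDegree ≤ S.card * c⁻¹ + c ^ 2 * 4 := by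
          refine (Finset.sum_le_sum hterm).trans ?_
          rw [Finset.sum_add_distrib, Finset.sum_const, nsmul_eq_mul, ← Finset.mul_sum]
          gcongr
          exact hsum.trans hinv
        have h2 : (S.card : ℝ) * c⁻¹ ≤ c ^ 2 := by
          calc (S.card : ℝ) * c⁻¹ ≤ c ^ 3 * c⁻¹ := by
                rw [hc3]
                gcongr
            _ = c ^ 2 := by field_simp
        linarith

end Counting

lemma Real.log_le_three_mul_rpow {x : ℝ} (hx : 0 ≤ x) : Real.log x ≤ 3 * x ^ (1 / 3 : ℝ) := by
  have := Real.log_le_rpow_div hx (ε := 1 / 3) (by norm_num)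
  linarith

lemma exp_le_rpow_div_log {q C : ℝ} (hq : 2 ≤ q) (hC : 120 ≤ C) {m : ℝ} (hm : 2 ≤ m) :
    Real.exp (20 * (m ^ (1 / 3 : ℝ)) ^ 2) ≤ q ^ (C * m / Real.log m) := by
  rw [Real.rpow_def_of_pos (show 0 < q by linarith)]
  apply Real.exp_le_exp.2
  have hlm : 0 < Real.log m := Real.log_pos (by linarith)
  have hl := Real.log_le_three_mul_rpow (x := m) (by linarith)
  have hlq : 1 / 2 ≤ Real.log q := by
    have := Real.log_le_log (by norm_num) hq
    linarith [Real.log_two_gt_d9]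
  set c := m ^ (1 / 3 : ℝ) with hcdef
  have hc : 0 < c := by positivity
  have hc3 : c ^ 3 = m := by
    rw [hcdef, ← Real.rpow_natCast, ← Real.rpow_mul (by linarith)]
    norm_num
  rw [← mul_div_assoc, le_div_iff₀ hlm]
  calc 20 * c ^ 2 * Real.log m ≤ 20 * c ^ 2 * (3 * c) := by gcongr
    _ = 1 / 2 * (120 * m) := by rw [← hc3]; ring
    _ ≤ Real.log q * (C * m) := by gcongr

open scoped Classical in
lemma isCoprime_iff_forall_normalizedFactors {F : Type*} [Field F] {f Q : Polynomial F}
    (hQ : Q ≠ 0) :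
    IsCoprime f Q ↔
      ∀ P ∈ (UniqueFactorizationMonoid.normalizedFactors Q).toFinset, ¬ P ∣ f := by
  constructor
  · intro h P hP hPf
    rw [Multiset.mem_toFinset] at hP
    exact (UniqueFactorizationMonoid.irreducible_of_normalized_factor P hP).not_isUnit
      (h.isUnit_of_dvd' hPf (UniqueFactorizationMonoid.dvd_of_mem_normalizedFactors hP))
  · intro h
    refine isCoprime_of_irreducible_dvd (fun h0 => hQ h0.2) fun z hz hzf hzQ => ?_
    obtain ⟨P, hP, hPz⟩ :=
      UniqueFactorizationMonoid.exists_mem_normalizedFactors_of_dvd hQ hz hzQ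
    exact h P (Multiset.mem_toFinset.2 hP) (hPz.symm.dvd.trans hzf)

open scoped Classical in
lemma card_normalizedFactors_le_natDegree {F : Type*} [Field F] {Q : Polynomial F} (hQ : Q ≠ 0) :
    (UniqueFactorizationMonoid.normalizedFactors Q).toFinset.card ≤ Q.natDegree := by
  have hdeg : Q.natDegree =
      ((UniqueFactorizationMonoid.normalizedFactors Q).map natDegree).sum := by
    rw [← natDegree_multiset_prod _ (UniqueFactorizationMonoid.zero_notMem_normalizedFactors Q)]
    exact natDegree_eq_of_degree_eq (degree_eq_degree_of_associated
      (UniqueFactorizationMonoid.prod_normalizedFactors hQ).symm)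
  refine (Multiset.toFinset_card_le _).trans ?_
  rw [hdeg]
  have := Multiset.card_nsmul_le_sum
    (s := (UniqueFactorizationMonoid.normalizedFactors Q).map natDegree) (a := 1) (by
      intro x hx
      obtain ⟨P, hP, rfl⟩ := Multiset.mem_map.1 hx
      exact (UniqueFactorizationMonoid.irreducible_of_normalized_factor P hP).natDegree_pos)
  simpa using this

/- There is a constant `C = C(q)` such that for every `Q` of degree `m ≥ 2` and every
`d ≥ 1`, `|∑_{f monic, deg f = d, gcd(f,Q)=1} μ(f)| ≤ C q^(d/2 + C·m/log m)`. -/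
open scoped Classical in
theorem moebius_coprime_sum_bound {F : Type*} [Field F] [Fintype F] (q : ℕ)
    (hq : Fintype.card F = q) :
    ∃ C : ℝ, ∀ Q : Polynomial F, 2 ≤ Q.natDegree → ∀ d : ℕ, 1 ≤ d →
      |∑ x : Fin d → F,
          (if IsCoprime (monicPoly F d x) Q then (polyMu (monicPoly F d x) : ℝ) else 0)| ≤
        C * (q : ℝ) ^ ((d : ℝ) / 2 +
          C * (Q.natDegree : ℝ) / Real.log (Q.natDegree : ℝ)) := by
  subst hq
  refine ⟨120 + √(Fintype.card F : ℝ), fun Q hQ d _ => ?_⟩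
  have hQ0 : Q ≠ 0 := by
    rintro rfl
    simp at hQ
  have hq2 : (2 : ℝ) ≤ Fintype.card F := by exact_mod_cast Fintype.one_lt_card (α := F)
  set S := (UniqueFactorizationMonoid.normalizedFactors Q).toFinset with hSdef
  have hS : ∀ P ∈ S, P.Monic ∧ Irreducible P := fun P hP => by
    rw [hSdef, Multiset.mem_toFinset] at hP
    have hirr := UniqueFactorizationMonoid.irreducible_of_normalized_factor P hP
    refine ⟨?_, hirr⟩
    rw [← UniqueFactorizationMonoid.normalize_normalized_factor P hP]
    exact monic_normalize hirr.ne_zero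
  have hsum : ∑ x : Fin d → F,
      (if IsCoprime (monicPoly F d x) Q then (polyMu (monicPoly F d x) : ℝ) else 0) =
      ((PowerSeries.coeff d (moebiusSeries S) : ℤ) : ℝ) := by
    rw [moebiusSeries, PowerSeries.coeff_mk, monicsAvoiding, Finset.sum_filter, monicsOfDegree,
      Finset.sum_image (monicPoly_injective d).injOn, Int.cast_sum]
    refine Finset.sum_congr rfl fun x _ => ?_
    simp only [isCoprime_iff_forall_normalizedFactors hQ0, ← hSdef]
    split_ifs <;> simp
  have hsd : √(Fintype.card F : ℝ) ^ d = (Fintype.card F : ℝ) ^ ((d : ℝ) / 2) := by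
    rw [Real.sqrt_eq_rpow, ← Real.rpow_natCast, ← Real.rpow_mul (by positivity)]
    congr 1
    ring
  rw [hsum, Real.rpow_add (by positivity), ← hsd]
  have hprod := (prod_inv_one_sub_le_exp S hS (m := Q.natDegree) (by omega)
    (card_normalizedFactors_le_natDegree hQ0)).trans
    (exp_le_rpow_div_log hq2 (C := 120 + √(Fintype.card F : ℝ))
      (by linarith [Real.sqrt_nonneg (Fintype.card F : ℝ)]) (by exact_mod_cast hQ))
  refine (abs_coeff_moebiusSeries_le S hS d).trans ?_
  rw [mul_assoc, mul_comm (√(Fintype.card F : ℝ) ^ d)]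
  have hnonneg := Finset.prod_nonneg fun P (_ : P ∈ S) => inv_nonneg.2 <| sub_nonneg.2 <|
    pow_le_one₀ (n := P.natDegree) (by positivity)
      ((inv_sqrt_card_le (F := F)).trans (by norm_num))
  gcongr
  linarith
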